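/- arXiv:1609.07467 — 2 statements merged into one kernel-verified Lean document; each statement's English description precedes it below -/
import Mathlib

section
/- Quadratic moment bound (Lemma on moments of the quadratic part): For every real k ≥ 1 there exists a constant C_k > 0 depending only on k such that for every measurable f : (0,∞) → [0,∞), 8π² ∫₀^∞∫₀^∞ K(x,y) f(x) f(y) ( (x+y)^k − x^k − y^k ) dx dy ≤ C_k ( m_{k+3}⟨f⟩ · m₃⟨f⟩ + m_{k+1}⟨f⟩ · m₅⟨f⟩ ). In particular, if moreover ess sup f(r)r² < ∞ and m_j⟨f⟩ < ∞ for 0 ≤ j ≤ k+7, then ∫₀^∞ Q_q[f](r) r^k dr ≤ C_k ( m_{k+3}⟨f⟩ m₃⟨f⟩ + m_{k+1}⟨f⟩ m₅⟨f⟩ ). -/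
open MeasureTheory Set Real Filter
open scoped ENNReal

/-- The collision kernel `K(x,y) = x²y²(x+y)²`. -/
noncomputable def Kker (x y : ℝ) : ℝ := x ^ 2 * y ^ 2 * (x + y) ^ 2

/-- The `k`-th line-moment `m_k⟨f⟩ = ∫₀^∞ f(r) r^k dr`. -/
noncomputable def lm (f : ℝ → ℝ) (k : ℝ) : ℝ := ∫ r in Ioi (0 : ℝ), f r * r ^ k

/-- Quadratic part of the radial collision operator (polar Jacobian included). -/
noncomputable def Qq (f : ℝ → ℝ) (r : ℝ) : ℝ :=
  8 * π ^ 2 *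
    ((∫ s in (0 : ℝ)..r, Kker s (r - s) * f s * f (r - s)) +
      2 * (∫ s in Ioi r, Kker r (s - r) * f s * f (s - r)) +
      2 * f r *
        ((∫ s in Ioi r, Kker r (s - r) * f s) -
          (∫ s in (0 : ℝ)..r, Kker s (r - s) * f s) -
          (∫ s in Ioi (0 : ℝ), Kker r s * f s)))

/-- Linear part of the radial collision operator (polar Jacobian included). -/
noncomputable def Lop (f : ℝ → ℝ) (r : ℝ) : ℝ :=
  8 * π ^ 2 *
    (2 * (∫ s in Ioi r, Kker r (s - r) * f s) -
      f r * (∫ s in (0 : ℝ)..r, Kker s (r - s)))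

/-- The full radial collision operator `𝒬[f] = Q_q[f] + L[f]`. -/
noncomputable def Qcol (f : ℝ → ℝ) (r : ℝ) : ℝ := Qq f r + Lop f r

/-- The constant `κ₀ = 9/(64 π² m)`. -/
noncomputable def kappa0 (mass : ℝ) : ℝ := 9 / (64 * π ^ 2 * mass)

/-- `k`-th line-moment as an extended-real (Lebesgue) integral. -/
noncomputable def lmE (f : ℝ → ℝ) (k : ℝ) : ℝ≥0∞ :=
  ∫⁻ r in Ioi (0 : ℝ), ENNReal.ofReal (f r * r ^ k)

lemma add_rpow_sub_rpow_le {k : ℝ} (hk : 1 ≤ k) {x y : ℝ} (hy : 0 < y) (hyx : y ≤ x) :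
    (x + y) ^ k - x ^ k ≤ k * 2 ^ (k - 1) * y * x ^ (k - 1) := by
  have hx : 0 < x := hy.trans_le hyx
  have hs : 0 < x + y := by positivity
  have h1 : (1 : ℝ) + k * (-(y / (x + y))) ≤ (1 + -(y / (x + y))) ^ k := by
    refine one_add_mul_self_le_rpow_one_add ?_ hk
    rw [neg_le_neg_iff, div_le_one hs]
    linarith
  have h2 : 1 + -(y / (x + y)) = x / (x + y) := by field_simp; ring
  rw [h2, div_rpow hx.le hs.le, le_div_iff₀ (rpow_pos_of_pos hs k)] at h1
  have h3 : (x + y) ^ k = (x + y) ^ (k - 1) * (x + y) := by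
    rw [← rpow_add_one hs.ne']; ring_nf
  have h4 : (x + y) ^ (k - 1) ≤ 2 ^ (k - 1) * x ^ (k - 1) := by
    rw [← mul_rpow (by norm_num) hx.le]
    exact rpow_le_rpow hs.le (by linarith) (by linarith)
  have h5 : (1 + k * (-(y / (x + y)))) * (x + y) ^ k
      = (x + y) ^ k - k * y * (x + y) ^ (k - 1) := by
    rw [h3]; field_simp; ring
  rw [h5] at h1
  have h6 := mul_le_mul_of_nonneg_left h4 (by positivity : 0 ≤ k * y)
  linarith

lemma Kker_comm (x y : ℝ) : Kker x y = Kker y x := by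
  unfold Kker; ring

lemma Kker_mul_excess_le_of_le {k : ℝ} (hk : 1 ≤ k) {x y : ℝ} (hy : 0 < y) (hyx : y ≤ x) :
    Kker x y * ((x + y) ^ k - x ^ k - y ^ k) ≤
      4 * (k * 2 ^ (k - 1)) * (x ^ (k + 3) * y ^ (3 : ℝ)) := by
  have hx : 0 < x := hy.trans_le hyx
  have h := add_rpow_sub_rpow_le hk hy hyx
  have hyk : 0 ≤ y ^ k := by positivity
  have e1 : x ^ (k + 3) = x ^ (k - 1) * x ^ 4 := by
    rw [show k + 3 = (k - 1) + (4 : ℕ) by push_cast; ring, rpow_add_natCast hx.ne']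
  have e2 : y ^ (3 : ℝ) = y ^ 3 := by exact_mod_cast rpow_natCast y 3
  have hK : Kker x y ≤ 4 * (x ^ 4 * y ^ 2) := by
    have : (x + y) ^ 2 ≤ (2 * x) ^ 2 := by gcongr; linarith
    calc Kker x y ≤ x ^ 2 * y ^ 2 * (2 * x) ^ 2 := by unfold Kker; gcongr
      _ = _ := by ring
  have hK0 : 0 ≤ Kker x y := by unfold Kker; positivity
  calc Kker x y * ((x + y) ^ k - x ^ k - y ^ k)
      ≤ Kker x y * (k * 2 ^ (k - 1) * y * x ^ (k - 1)) := by gcongr; linarith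
    _ ≤ 4 * (x ^ 4 * y ^ 2) * (k * 2 ^ (k - 1) * y * x ^ (k - 1)) := by gcongr
    _ = _ := by rw [e1, e2]; ring

lemma Kker_mul_excess_le {k : ℝ} (hk : 1 ≤ k) {x y : ℝ} (hx : 0 < x) (hy : 0 < y) :
    Kker x y * ((x + y) ^ k - x ^ k - y ^ k) ≤
      4 * (k * 2 ^ (k - 1)) * (x ^ (k + 3) * y ^ (3 : ℝ) + x ^ (3 : ℝ) * y ^ (k + 3)) := by
  rcases le_total y x with h | h
  · refine (Kker_mul_excess_le_of_le hk hy h).trans ?_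
    gcongr
    exact le_add_of_nonneg_right (by positivity)
  · have := Kker_mul_excess_le_of_le hk hx h
    rw [Kker_comm, add_comm x y, sub_right_comm, mul_comm (x ^ (3 : ℝ))]
    refine this.trans ?_
    gcongr
    exact le_add_of_nonneg_left (by positivity)

lemma lintegral_Kker_mul_excess_le {k : ℝ} (hk : 1 ≤ k) {f : ℝ → ℝ} (hf : Measurable f)
    (hf0 : ∀ r, 0 ≤ f r) :
    (∫⁻ q in Ioi (0 : ℝ) ×ˢ Ioi (0 : ℝ),
      ENNReal.ofReal (8 * π ^ 2 * (Kker q.1 q.2 * f q.1 * f q.2 *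
        ((q.1 + q.2) ^ k - q.1 ^ k - q.2 ^ k)))) ≤
      ENNReal.ofReal (64 * π ^ 2 * (k * 2 ^ (k - 1))) * (lmE f (k + 3) * lmE f 3) := by
  set c : ℝ := 32 * π ^ 2 * (k * 2 ^ (k - 1)) with hc
  have hc0 : 0 ≤ c := by positivity
  set g : ℝ → ℝ → ℝ≥0∞ := fun j r => ENNReal.ofReal (f r * r ^ j) with hg
  have hgm : ∀ j, Measurable (g j) := fun j =>
    (hf.mul (measurable_id.pow_const j)).ennreal_ofReal
  calc _ ≤ ∫⁻ q in Ioi (0 : ℝ) ×ˢ Ioi (0 : ℝ),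
        ENNReal.ofReal c * (g (k + 3) q.1 * g 3 q.2 + g 3 q.1 * g (k + 3) q.2) := by
        refine setLIntegral_mono_ae' (measurableSet_Ioi.prod measurableSet_Ioi)
          (Eventually.of_forall ?_)
        rintro ⟨x, y⟩ ⟨hx, hy⟩
        simp only [mem_Ioi] at hx hy
        have hx' := hf0 x
        have hy' := hf0 y
        simp only [hg]
        rw [← ENNReal.ofReal_mul (by positivity), ← ENNReal.ofReal_mul (by positivity),
          ← ENNReal.ofReal_add (by positivity) (by positivity), ← ENNReal.ofReal_mul hc0]
        apply ENNReal.ofReal_le_ofReal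
        have h := mul_le_mul_of_nonneg_left (Kker_mul_excess_le hk hx hy)
          (by positivity : 0 ≤ 8 * π ^ 2 * (f x * f y))
        rw [hc]
        linarith
    _ = _ := by
        rw [Measure.volume_eq_prod, ← Measure.prod_restrict, lintegral_const_mul _ (by fun_prop),
          lintegral_add_left (by fun_prop),
          lintegral_prod_mul (hgm _).aemeasurable (hgm _).aemeasurable,
          lintegral_prod_mul (hgm _).aemeasurable (hgm _).aemeasurable,
          show 64 * π ^ 2 * (k * 2 ^ (k - 1)) = c + c by rw [hc]; ring,
          ENNReal.ofReal_add hc0 hc0]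
        change ENNReal.ofReal c * (lmE f (k + 3) * lmE f 3 + lmE f 3 * lmE f (k + 3)) = _
        ring

lemma integrable_mul_weight {k : ℝ} (hk : 1 ≤ k) {F : ℝ → ℝ} (hF : Measurable F)
    (hF0 : ∀ r, 0 ≤ F r) (hFn : ∀ r ≤ 0, F r = 0)
    (hm : ∀ j : ℝ, 0 ≤ j → j ≤ k + 7 → Integrable (fun r => F r * r ^ j))
    {W : ℝ × ℝ → ℝ} (hW : Measurable W)
    (hWb : ∀ x y, 0 < x → 0 < y → |W (x, y)| ≤ x ^ 2 * y ^ 2 * (x + y) ^ (k + 2)) :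
    Integrable (fun z : ℝ × ℝ => F z.1 * F z.2 * W z) := by
  have h2 := hm 2 (by linarith) (by linarith)
  have h4 := hm (k + 4) (by linarith) (by linarith)
  have hb := ((h4.mul_prod h2).add (h2.mul_prod h4)).const_mul (2 ^ (k + 2))
  rw [← Measure.volume_eq_prod] at hb
  refine hb.mono' (by fun_prop) (Eventually.of_forall ?_)
  rintro ⟨x, y⟩
  rcases le_or_gt x 0 with hx | hx
  · simp [hFn x hx]
  rcases le_or_gt y 0 with hy | hy
  · simp [hFn y hy]
  have hx' := hF0 x
  have hy' := hF0 y
  have e : ∀ {t : ℝ}, 0 < t → t ^ (k + 4) = t ^ (k + 2) * t ^ 2 := fun {t} ht => by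
    rw [show k + 4 = (k + 2) + (2 : ℕ) by push_cast; ring, rpow_add_natCast ht.ne']
  have hs : (x + y) ^ (k + 2) ≤ 2 ^ (k + 2) * (x ^ (k + 2) + y ^ (k + 2)) := by
    have hmax : (x + y) ^ (k + 2) ≤ (2 * max x y) ^ (k + 2) :=
      rpow_le_rpow (by positivity)
        (by linarith [le_max_left x y, le_max_right x y]) (by linarith)
    rw [mul_rpow (by norm_num) (by positivity)] at hmax
    refine hmax.trans ?_
    gcongr
    rcases max_choice x y with h | h <;> rw [h]
    · exact le_add_of_nonneg_right (by positivity)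
    · exact le_add_of_nonneg_left (by positivity)
  simp only [Pi.add_apply, norm_eq_abs, abs_mul, abs_of_nonneg hx', abs_of_nonneg hy', rpow_two,
    e hx, e hy]
  calc F x * F y * |W (x, y)| ≤ F x * F y * (x ^ 2 * y ^ 2 *
        (2 ^ (k + 2) * (x ^ (k + 2) + y ^ (k + 2)))) := by
        gcongr
        exact (hWb x y hx hy).trans (by gcongr)
    _ = _ := by ring

lemma sq_mul_rpow_le {k : ℝ} (hk : 1 ≤ k) {a b c u v s : ℝ} (hc : 0 ≤ c)
    (hcs : c ≤ s) (hu : 0 ≤ u) (hv : 0 ≤ v) (hvs : v ≤ s) (hs : 0 < s)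
    (h : a ^ 2 * b ^ 2 * c ^ 2 = u) :
    |u * v ^ k| ≤ a ^ 2 * b ^ 2 * s ^ (k + 2) := by
  rw [abs_of_nonneg (by positivity), ← h,
    show k + 2 = k + (2 : ℕ) by push_cast; ring, rpow_add_natCast hs.ne']
  calc a ^ 2 * b ^ 2 * c ^ 2 * v ^ k ≤ a ^ 2 * b ^ 2 * s ^ 2 * s ^ k := by gcongr
    _ = _ := by ring

lemma integral_Qq_mul_rpow_le {k : ℝ} (hk : 1 ≤ k) {f : ℝ → ℝ} (hf : Measurable f)
    (hf0 : ∀ r, 0 ≤ f r)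
    (hm : ∀ j : ℝ, 0 ≤ j → j ≤ k + 7 → IntegrableOn (fun r => f r * r ^ j) (Ioi (0 : ℝ))) :
    (∫ r in Ioi (0 : ℝ), Qq f r * r ^ k) ≤
      64 * π ^ 2 * (k * 2 ^ (k - 1)) * (lm f (k + 3) * lm f 3) := by
  set F : ℝ → ℝ := (Ioi (0 : ℝ)).indicator f
  have hF : Measurable F := hf.indicator measurableSet_Ioi
  have hF0 : ∀ r, 0 ≤ F r := fun r => indicator_nonneg (fun r _ => hf0 r) r
  have hFn : ∀ r ≤ 0, F r = 0 := fun r hr => indicator_of_notMem (by simpa using hr) f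
  have hFp : ∀ r, 0 < r → F r = f r := fun r hr => indicator_of_mem (mem_Ioi.2 hr) f
  have hFm : ∀ j : ℝ, (fun r => F r * r ^ j) = (Ioi (0 : ℝ)).indicator (fun r => f r * r ^ j) :=
    fun j => by
      ext r
      rcases le_or_gt r 0 with hr | hr
      · simp [hFn r hr, hr]
      · simp [hFp r hr, hr]
  have hFI : ∀ j : ℝ, 0 ≤ j → j ≤ k + 7 → Integrable (fun r => F r * r ^ j) := fun j h0 h7 => by
    rw [hFm, integrable_indicator_iff measurableSet_Ioi]
    exact hm j h0 h7
  have hFlm : ∀ j : ℝ, ∫ r, F r * r ^ j = lm f j := fun j => by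
    rw [hFm, integral_indicator measurableSet_Ioi]
    rfl
  have hlt : MeasurableSet {z : ℝ × ℝ | z.2 < z.1} := measurableSet_lt measurable_snd measurable_fst
  have hgt : MeasurableSet {z : ℝ × ℝ | z.1 < z.2} := measurableSet_lt measurable_fst measurable_snd
  set W₁ : ℝ × ℝ → ℝ := fun z => Kker z.1 z.2 * (z.1 + z.2) ^ k with hW₁
  set W₂ : ℝ × ℝ → ℝ := {z : ℝ × ℝ | z.2 < z.1}.indicator
    (fun z => Kker (z.1 - z.2) z.2 * (z.1 - z.2) ^ k) with hW₂
  set W₃ : ℝ × ℝ → ℝ := {z : ℝ × ℝ | z.1 < z.2}.indicator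
    (fun z => Kker z.1 (z.2 - z.1) * z.1 ^ k) with hW₃
  set W₄ : ℝ × ℝ → ℝ := {z : ℝ × ℝ | z.2 < z.1}.indicator
    (fun z => Kker z.2 (z.1 - z.2) * z.1 ^ k) with hW₄
  set W₅ : ℝ × ℝ → ℝ := fun z => Kker z.1 z.2 * z.1 ^ k with hW₅
  set G : (ℝ × ℝ → ℝ) → ℝ × ℝ → ℝ := fun W z => F z.1 * F z.2 * W z with hG
  have hint : ∀ W : ℝ × ℝ → ℝ, Measurable W →
      (∀ x y, 0 < x → 0 < y → |W (x, y)| ≤ x ^ 2 * y ^ 2 * (x + y) ^ (k + 2)) →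
      Integrable (G W) := fun W h h' => integrable_mul_weight hk hF hF0 hFn hFI h h'
  have hK : ∀ x y, 0 ≤ Kker x y := fun x y => by unfold Kker; positivity
  have i₁ : Integrable (G W₁) := hint _ (by unfold W₁ Kker; fun_prop) fun x y hx hy =>
    sq_mul_rpow_le hk (c := x + y) (by positivity) le_rfl (hK _ _) (by positivity) le_rfl
      (by positivity) (by simp only [Kker])
  have i₂ : Integrable (G W₂) := by
    refine hint _ (Measurable.indicator (by unfold Kker; fun_prop) hlt) fun x y hx hy => ?_
    by_cases h : y < x
    · simp only [hW₂, indicator, mem_ofPred_eq, h, if_true]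
      exact sq_mul_rpow_le hk (c := x - y) (by linarith) (by linarith) (hK _ _)
        (by linarith) (by linarith) (by positivity) (by simp only [Kker]; ring)
    · simp only [hW₂, indicator, mem_ofPred_eq, h, if_false, abs_zero]
      positivity
  have i₃ : Integrable (G W₃) := by
    refine hint _ (Measurable.indicator (by unfold Kker; fun_prop) hgt) fun x y hx hy => ?_
    by_cases h : x < y
    · simp only [hW₃, indicator, mem_ofPred_eq, h, if_true]
      exact sq_mul_rpow_le hk (c := y - x) (by linarith) (by linarith) (hK _ _)
        (by linarith) (by linarith) (by positivity) (by simp only [Kker]; ring)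
    · simp only [hW₃, indicator, mem_ofPred_eq, h, if_false, abs_zero]
      positivity
  have i₄ : Integrable (G W₄) := by
    refine hint _ (Measurable.indicator (by unfold Kker; fun_prop) hlt) fun x y hx hy => ?_
    by_cases h : y < x
    · simp only [hW₄, indicator, mem_ofPred_eq, h, if_true]
      exact sq_mul_rpow_le hk (c := x - y) (by linarith) (by linarith) (hK _ _)
        (by linarith) (by linarith) (by positivity) (by simp only [Kker]; ring)
    · simp only [hW₄, indicator, mem_ofPred_eq, h, if_false, abs_zero]
      positivity
  have i₅ : Integrable (G W₅) := hint _ (by unfold W₅ Kker; fun_prop) fun x y hx hy =>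
    sq_mul_rpow_le hk (c := x + y) (by positivity) le_rfl (hK _ _) hx.le (by linarith)
      (by positivity) (by simp only [Kker])
  have mp₁ : MeasurePreserving (fun z : ℝ × ℝ => (z.2, z.1 - z.2)) volume volume :=
    measurePreserving_prod_sub_swap volume volume
  have mp₂ : MeasurePreserving (fun z : ℝ × ℝ => (z.2, z.2 - z.1)) volume volume := by
    have := ((MeasurePreserving.id (volume : Measure ℝ)).prod
      (Measure.measurePreserving_neg (volume : Measure ℝ))).comp mp₁
    have e : (fun z : ℝ × ℝ => (z.2, z.2 - z.1)) =
        Prod.map id Neg.neg ∘ fun z : ℝ × ℝ => (z.2, z.1 - z.2) := by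
      ext z <;> simp
    rw [e]
    exact this
  have j₁ : Integrable (fun z : ℝ × ℝ => G W₁ (z.2, z.1 - z.2)) (volume.prod volume) :=
    mp₁.integrable_comp_of_integrable i₁
  have j₂ : Integrable (fun z : ℝ × ℝ => G W₂ (z.2, z.2 - z.1)) (volume.prod volume) :=
    mp₂.integrable_comp_of_integrable i₂
  have hG₂ : ∀ x y, y ≤ 0 → ∀ W, G W (x, y) = 0 := fun x y hy W => by simp [hG, hFn y hy]
  have hG₁ : ∀ x y, x ≤ 0 → ∀ W, G W (x, y) = 0 := fun x y hx W => by simp [hG, hFn x hx]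
  have key : ∀ r, (Ioi (0 : ℝ)).indicator (fun r => Qq f r * r ^ k) r =
      8 * π ^ 2 * ((∫ s, G W₁ (s, r - s)) + 2 * (∫ s, G W₂ (s, s - r)) +
        2 * ((∫ s, G W₃ (r, s)) - (∫ s, G W₄ (r, s)) - (∫ s, G W₅ (r, s)))) := by
    intro r
    rcases le_or_gt r 0 with hr | hr
    · have a₁ : ∀ s, G W₁ (s, r - s) = 0 := fun s => by
        rcases le_or_gt s 0 with hs | hs
        · exact hG₁ _ _ hs _
        · exact hG₂ _ _ (by linarith) _
      have a₂ : ∀ s, G W₂ (s, s - r) = 0 := fun s => by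
        simp [hG, hW₂, indicator, hr]
      simp [a₁, a₂, hG₁ _ _ hr, hr]
    have b₁ : ∫ s, G W₁ (s, r - s) =
        (∫ s in (0 : ℝ)..r, Kker s (r - s) * f s * f (r - s)) * r ^ k := by
      rw [intervalIntegral.integral_of_le hr.le, ← integral_indicator measurableSet_Ioc,
        ← integral_mul_const]
      congr 1 with s
      rcases le_or_gt s 0 with hs | hs
      · simp [hG₁ _ _ hs, hs]
      rcases lt_trichotomy s r with h | h | h
      · simp only [hG, hW₁, hFp s hs, hFp (r - s) (by linarith), indicator, mem_Ioc, hs, h.le,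
          and_self, if_true, add_sub_cancel]
        ring
      · simp [hG, hW₁, indicator, h, Kker]
      · rw [hG₂ _ _ (by linarith)]
        simp [indicator, h]
    have b₂ : ∫ s, G W₂ (s, s - r) =
        (∫ s in Ioi r, Kker r (s - r) * f s * f (s - r)) * r ^ k := by
      rw [← integral_indicator measurableSet_Ioi, ← integral_mul_const]
      congr 1 with s
      rcases le_or_gt s r with h | h
      · rw [hG₂ _ _ (by linarith)]
        simp [h]
      · simp only [hG, hW₂, hFp s (hr.trans h), hFp (s - r) (by linarith), indicator,
          mem_ofPred_eq, mem_Ioi, h, show s - r < s by linarith, if_true, sub_sub_cancel]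
        ring
    have b₃ : ∫ s, G W₃ (r, s) = f r * (∫ s in Ioi r, Kker r (s - r) * f s) * r ^ k := by
      rw [← integral_indicator measurableSet_Ioi, ← integral_const_mul, ← integral_mul_const]
      congr 1 with s
      rcases le_or_gt s r with h | h
      · simp [hG, hW₃, indicator, h.not_gt]
      · simp only [hG, hW₃, hFp s (hr.trans h), hFp r hr, indicator, mem_ofPred_eq, mem_Ioi, h,
          if_true]
        ring
    have b₄ : ∫ s, G W₄ (r, s) =
        f r * (∫ s in (0 : ℝ)..r, Kker s (r - s) * f s) * r ^ k := by
      rw [intervalIntegral.integral_of_le hr.le, ← integral_indicator measurableSet_Ioc,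
        ← integral_const_mul, ← integral_mul_const]
      congr 1 with s
      rcases le_or_gt s 0 with hs | hs
      · simp [hG₂ _ _ hs, hs]
      rcases lt_trichotomy s r with h | h | h
      · simp only [hG, hW₄, hFp s hs, hFp r hr, indicator, mem_Ioc, mem_ofPred_eq, hs, h, h.le,
          and_self, if_true]
        ring
      · simp [hG, hW₄, indicator, h, Kker]
      · simp [hG, hW₄, indicator, h.not_gt, h.not_ge]
    have b₅ : ∫ s, G W₅ (r, s) = f r * (∫ s in Ioi (0 : ℝ), Kker r s * f s) * r ^ k := by
      rw [← integral_indicator measurableSet_Ioi, ← integral_const_mul, ← integral_mul_const]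
      congr 1 with s
      rcases le_or_gt s 0 with hs | hs
      · simp [hG₂ _ _ hs, hs]
      · simp only [hG, hW₅, hFp s hs, hFp r hr, indicator, mem_Ioi, hs, if_true]
        ring
    rw [b₁, b₂, b₃, b₄, b₅, indicator_of_mem (mem_Ioi.2 hr), Qq]
    ring
  rw [Measure.volume_eq_prod] at i₁ i₂ i₃ i₄ i₅
  have hsum : ∫ r in Ioi (0 : ℝ), Qq f r * r ^ k =
      8 * π ^ 2 * ((∫ z, G W₁ z) + 2 * (∫ z, G W₂ z) +
        2 * ((∫ z, G W₃ z) - (∫ z, G W₄ z) - (∫ z, G W₅ z))) := by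
    have c₁ : ∫ z, G W₁ z = ∫ r, ∫ s, G W₁ (s, r - s) := by
      rw [← integral_prod _ j₁, ← Measure.volume_eq_prod, ← mp₁.map_eq,
        integral_map mp₁.aemeasurable (by rw [mp₁.map_eq]; exact i₁.aestronglyMeasurable),
        mp₁.map_eq]
    have c₂ : ∫ z, G W₂ z = ∫ r, ∫ s, G W₂ (s, s - r) := by
      rw [← integral_prod _ j₂, ← Measure.volume_eq_prod, ← mp₂.map_eq,
        integral_map mp₂.aemeasurable (by rw [mp₂.map_eq]; exact i₂.aestronglyMeasurable),
        mp₂.map_eq]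
    rw [c₁, c₂, Measure.volume_eq_prod, integral_prod _ i₃, integral_prod _ i₄,
      integral_prod _ i₅, ← integral_indicator measurableSet_Ioi]
    simp_rw [key]
    have l₁ : Integrable (fun r => ∫ s, G W₁ (s, r - s)) := j₁.integral_prod_left
    have l₂ : Integrable (fun r => 2 * ∫ s, G W₂ (s, s - r)) := j₂.integral_prod_left.const_mul 2
    have l₃ := i₃.integral_prod_left
    have l₄ := i₄.integral_prod_left
    have l₅ := i₅.integral_prod_left
    have l₁₂ : Integrable (fun r => (∫ s, G W₁ (s, r - s)) + 2 * ∫ s, G W₂ (s, s - r)) := l₁.add l₂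
    have l₃₄ : Integrable (fun r => (∫ s, G W₃ (r, s)) - ∫ s, G W₄ (r, s)) := l₃.sub l₄
    have l₃₅ : Integrable
        (fun r => 2 * ((∫ s, G W₃ (r, s)) - (∫ s, G W₄ (r, s)) - ∫ s, G W₅ (r, s))) :=
      (l₃₄.sub l₅).const_mul 2
    rw [integral_const_mul, integral_add l₁₂ l₃₅, integral_add l₁ l₂, integral_const_mul,
      integral_const_mul, integral_sub l₃₄ l₅, integral_sub l₃ l₄]
  have hloss : (∫ z, G W₂ z) + (∫ z, G W₃ z) - (∫ z, G W₄ z) ≤ 0 := by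
    have i₃' : Integrable (fun z : ℝ × ℝ => G W₃ z.swap) (volume.prod volume) := i₃.swap
    have i₂₃ : Integrable (fun z : ℝ × ℝ => G W₂ z + G W₃ z.swap) (volume.prod volume) :=
      i₂.add i₃'
    rw [Measure.volume_eq_prod, ← integral_prod_swap (G W₃), ← integral_add i₂ i₃',
      ← integral_sub i₂₃ i₄]
    refine integral_nonpos ?_
    rintro ⟨x, y⟩
    rcases le_or_gt y 0 with hy | hy
    · simp [hG₂ _ _ hy, hG₁ _ _ hy]
    by_cases h : y < x
    · have hp := add_rpow_le_rpow_add (sub_nonneg.2 h.le) hy.le hk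
      rw [sub_add_cancel] at hp
      have h0 : 0 ≤ F x * F y * Kker y (x - y) :=
        mul_nonneg (mul_nonneg (hF0 x) (hF0 y)) (hK _ _)
      have := mul_le_mul_of_nonneg_left hp h0
      simp only [hG, hW₂, hW₃, hW₄, indicator, mem_ofPred_eq, Prod.swap_prod_mk, h, if_true,
        Kker_comm (x - y) y, Pi.zero_apply]
      linarith
    · simp [hG, hW₂, hW₃, hW₄, indicator, h]
  have hgain : (∫ z, G W₁ z) - 2 * (∫ z, G W₅ z) ≤
      8 * (k * 2 ^ (k - 1)) * (lm f (k + 3) * lm f 3) := by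
    have m₁ := hFI (k + 3) (by linarith) (by linarith)
    have m₂ := hFI 3 (by linarith) (by linarith)
    have hR : ∫ z : ℝ × ℝ, 4 * (k * 2 ^ (k - 1)) *
        ((F z.1 * z.1 ^ (k + 3)) * (F z.2 * z.2 ^ (3 : ℝ)) +
          (F z.1 * z.1 ^ (3 : ℝ)) * (F z.2 * z.2 ^ (k + 3))) ∂(volume.prod volume) =
        8 * (k * 2 ^ (k - 1)) * (lm f (k + 3) * lm f 3) := by
      rw [integral_const_mul, integral_add (m₁.mul_prod m₂) (m₂.mul_prod m₁),
        integral_prod_mul (fun x => F x * x ^ (k + 3)) (fun y => F y * y ^ (3 : ℝ)),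
        integral_prod_mul (fun x => F x * x ^ (3 : ℝ)) (fun y => F y * y ^ (k + 3)), hFlm, hFlm]
      ring
    rw [← hR, two_mul, ← sub_sub, Measure.volume_eq_prod]
    nth_rewrite 2 [← integral_prod_swap (G W₅)]
    have i₅' : Integrable (fun z : ℝ × ℝ => G W₅ z.swap) (volume.prod volume) := i₅.swap
    have i₁₅ : Integrable (fun z : ℝ × ℝ => G W₁ z - G W₅ z) (volume.prod volume) := i₁.sub i₅
    rw [← integral_sub i₁ i₅, ← integral_sub i₁₅ i₅']
    refine integral_mono (i₁₅.sub i₅')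
      (((m₁.mul_prod m₂).add (m₂.mul_prod m₁)).const_mul _) ?_
    rintro ⟨x, y⟩
    rcases le_or_gt x 0 with hx | hx
    · simp [hG₂ _ _ hx, hG₁ _ _ hx, hFn x hx]
    rcases le_or_gt y 0 with hy | hy
    · simp [hG₂ _ _ hy, hG₁ _ _ hy, hFn y hy]
    have := mul_le_mul_of_nonneg_left (Kker_mul_excess_le hk hx hy)
      (mul_nonneg (hF0 x) (hF0 y))
    simp only [hG, hW₁, hW₅, Prod.swap_prod_mk, Kker_comm y x]
    linarith
  rw [hsum]
  calc _ ≤ 8 * π ^ 2 * (8 * (k * 2 ^ (k - 1)) * (lm f (k + 3) * lm f 3)) := by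
        gcongr
        linarith
    _ = _ := by ring

/-- Quadratic moment bound. -/
theorem quadratic_moment_bound (k : ℝ) (hk : 1 ≤ k) :
    ∃ C : ℝ, 0 < C ∧
      ∀ f : ℝ → ℝ, Measurable f → (∀ r, 0 ≤ f r) →
        ((∫⁻ q in Ioi (0 : ℝ) ×ˢ Ioi (0 : ℝ),
            ENNReal.ofReal (8 * π ^ 2 * (Kker q.1 q.2 * f q.1 * f q.2 *
              ((q.1 + q.2) ^ k - q.1 ^ k - q.2 ^ k)))) ≤
          ENNReal.ofReal C * (lmE f (k + 3) * lmE f 3 + lmE f (k + 1) * lmE f 5)) ∧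
        ((∃ M : ℝ, ∀ᵐ r ∂(volume.restrict (Ioi (0 : ℝ))), f r * r ^ 2 ≤ M) →
          (∀ j : ℝ, 0 ≤ j → j ≤ k + 7 →
            IntegrableOn (fun r => f r * r ^ j) (Ioi (0 : ℝ))) →
          (∫ r in Ioi (0 : ℝ), Qq f r * r ^ k) ≤
            C * (lm f (k + 3) * lm f 3 + lm f (k + 1) * lm f 5)) := by
  refine ⟨64 * π ^ 2 * (k * 2 ^ (k - 1)), by positivity, fun f hf hf0 => ⟨?_, fun _ hm => ?_⟩⟩
  · refine (lintegral_Kker_mul_excess_le hk hf hf0).trans ?_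
    gcongr
    exact le_self_add
  · refine (integral_Qq_mul_rpow_le hk hf hf0 hm).trans ?_
    have hlm : ∀ j, 0 ≤ lm f j := fun j =>
      setIntegral_nonneg measurableSet_Ioi fun r hr =>
        mul_nonneg (hf0 r) (rpow_nonneg (mem_Ioi.1 hr).le j)
    have := mul_nonneg (hlm (k + 1)) (hlm 5)
    gcongr
    linarith
end

section
/- Hölder continuity of the collision operator on the invariant set: Let T, δ > 0 and suppose f, g ∈ C([0,T];𝒮) satisfy n_c[f](t) ≥ δ and n_c[g](t) ≥ δ for all t ∈ [0,T]. Then there exist constants C₁ depending only on (δ, T, 𝔥₃, 𝔥₈, 𝔥∞) and C₂ depending only on (δ, 𝔥₃, 𝔥₈, 𝔥∞) such that for all 0 ≤ t ≤ s ≤ T: ∫₀^∞ | (κ₀/n_c[f](t)) 𝒬[f(t)](r) − (κ₀/n_c[g](s)) 𝒬[g(s)](r) | dr ≤ C₁ ( sup_{σ∈[0,t]} d(f(σ),g(σ))^{1/6} + sup_{σ∈[0,t]} d(f(σ),g(σ)) ) + C₂ ( d(f(t),g(s))^{1/6} + d(f(t),g(s)) + |t−s| ). -/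
open MeasureTheory Set Real Filter

/-- Membership in the bounded convex set `𝒮` determined by `𝔥₃, 𝔥₈, 𝔥∞`. -/
def memS (h3 h8 hinf : ℝ) (f : ℝ → ℝ) : Prop :=
  Measurable f ∧ (∀ r, 0 ≤ f r) ∧
  IntegrableOn (fun r => f r * r ^ (3 : ℝ)) (Ioi (0 : ℝ)) ∧ lm f 3 = h3 ∧
  IntegrableOn (fun r => f r * r ^ (8 : ℝ)) (Ioi (0 : ℝ)) ∧ lm f 8 ≤ h8 ∧
  (∀ᵐ r ∂(volume.restrict (Ioi (0 : ℝ))), f r * r ^ 2 ≤ hinf)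

/-- The `L¹(ℝ³)`-type distance on radial profiles (up to the factor `4π`). -/
noncomputable def dS (u v : ℝ → ℝ) : ℝ := ∫ r in Ioi (0 : ℝ), |u r - v r| * r ^ 2

/-- Continuity of a curve `t ↦ f(t)` with values in `𝒮` for the distance `dS`. -/
def contS (T : ℝ) (f : ℝ → ℝ → ℝ) : Prop :=
  ∀ t₀ ∈ Icc (0 : ℝ) T, ∀ ε : ℝ, 0 < ε → ∃ η : ℝ, 0 < η ∧
    ∀ t ∈ Icc (0 : ℝ) T, |t - t₀| < η → dS (f t) (f t₀) < ε

/-- The condensate mass functional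
`n_c[f](t) = √(n₀² − 2κ₀ ∫₀^t ∫₀^∞ 𝒬[f(s)](r) dr ds)`. -/
noncomputable def ncF (mass n0 : ℝ) (f : ℝ → ℝ → ℝ) (t : ℝ) : ℝ :=
  Real.sqrt (n0 ^ 2 - 2 * kappa0 mass * ∫ s in (0 : ℝ)..t, ∫ r in Ioi (0 : ℝ), Qcol (f s) r)

/-- The weight `x² + x⁷` on the positive half-line, extended by zero. -/
noncomputable def collisionWeight (x : ℝ) : ℝ := (Ioi (0 : ℝ)).indicator (fun x => x ^ 2 + x ^ 7) x

lemma collisionWeight_nonneg (x : ℝ) : 0 ≤ collisionWeight x :=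
  indicator_nonneg (fun x (hx : 0 < x) => by positivity) x

lemma measurable_collisionWeight : Measurable collisionWeight :=
  (by fun_prop : Measurable fun x : ℝ => x ^ 2 + x ^ 7).indicator measurableSet_Ioi

/-- The modulus of continuity `d ↦ d^{1/6} + d`. -/
noncomputable def holderModulus (d : ℝ) : ℝ := d ^ ((1 : ℝ) / 6) + d

lemma holderModulus_nonneg {d : ℝ} (hd : 0 ≤ d) : 0 ≤ holderModulus d := by
  unfold holderModulus; positivity

lemma holderModulus_mono {d e : ℝ} (hd : 0 ≤ d) (h : d ≤ e) :
    holderModulus d ≤ holderModulus e := by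
  unfold holderModulus; gcongr

lemma dS_nonneg (u v : ℝ → ℝ) : 0 ≤ dS u v :=
  integral_nonneg fun r => by positivity

section Moments

variable {h3 h8 hinf : ℝ} {f g : ℝ → ℝ}

lemma memS.integrableOn_pow_three (hf : memS h3 h8 hinf f) :
    IntegrableOn (fun r => f r * r ^ 3) (Ioi (0 : ℝ)) := by
  simpa only [rpow_ofNat] using hf.2.2.1

lemma memS.integral_pow_three (hf : memS h3 h8 hinf f) :
    ∫ r in Ioi (0 : ℝ), f r * r ^ 3 = h3 := by
  simpa only [lm, rpow_ofNat] using hf.2.2.2.1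

lemma memS.integrableOn_pow_eight (hf : memS h3 h8 hinf f) :
    IntegrableOn (fun r => f r * r ^ 8) (Ioi (0 : ℝ)) := by
  simpa only [rpow_ofNat] using hf.2.2.2.2.1

lemma memS.integral_pow_eight_le (hf : memS h3 h8 hinf f) :
    ∫ r in Ioi (0 : ℝ), f r * r ^ 8 ≤ h8 := by
  simpa only [lm, rpow_ofNat] using hf.2.2.2.2.2.1

lemma memS.integrableOn_pow_two_and_integral_le (hf : memS h3 h8 hinf f) :
    IntegrableOn (fun r => f r * r ^ 2) (Ioi (0 : ℝ)) ∧
      ∫ r in Ioi (0 : ℝ), f r * r ^ 2 ≤ hinf + h3 := by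
  have hi : IntegrableOn (fun r : ℝ => (Ioc (0 : ℝ) 1).indicator (fun _ => hinf) r) (Ioi 0) := by
    apply Integrable.integrableOn
    rw [integrable_indicator_iff measurableSet_Ioc]
    exact integrableOn_const (by simp)
  have hle : ∀ᵐ r ∂(volume.restrict (Ioi (0 : ℝ))),
      f r * r ^ 2 ≤ (Ioc (0 : ℝ) 1).indicator (fun _ => hinf) r + f r * r ^ 3 := by
    filter_upwards [hf.2.2.2.2.2.2, ae_restrict_mem measurableSet_Ioi] with r hr hr0
    have hfr := hf.2.1 r
    have hr0 : 0 < r := hr0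
    by_cases h : r ≤ 1
    · rw [indicator_of_mem (show r ∈ Ioc (0 : ℝ) 1 from ⟨hr0, h⟩)]
      have : 0 ≤ f r * r ^ 3 := by positivity
      linarith
    · rw [indicator_of_notMem (fun h' => h h'.2), zero_add]
      exact mul_le_mul_of_nonneg_left (pow_le_pow_right₀ (by linarith) (by norm_num)) hfr
  have hint : IntegrableOn (fun r => f r * r ^ 2) (Ioi (0 : ℝ)) := by
    refine Integrable.mono' (hi.add hf.integrableOn_pow_three)
      (hf.1.mul (by fun_prop)).aestronglyMeasurable ?_
    filter_upwards [hle] with r hr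
    rw [Real.norm_of_nonneg (mul_nonneg (hf.2.1 r) (by positivity))]
    exact hr
  refine ⟨hint, (integral_mono_ae hint (hi.add hf.integrableOn_pow_three) hle).trans ?_⟩
  simp only [Pi.add_apply]
  rw [integral_add hi hf.integrableOn_pow_three, hf.integral_pow_three,
    setIntegral_indicator measurableSet_Ioc, inter_eq_self_of_subset_right Ioc_subset_Ioi_self]
  simp

lemma memS.integrableOn_pow_seven (hf : memS h3 h8 hinf f) :
    IntegrableOn (fun r => f r * r ^ 7) (Ioi (0 : ℝ)) := by
  refine Integrable.mono' (hf.integrableOn_pow_three.add hf.integrableOn_pow_eight)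
    (hf.1.mul (by fun_prop)).aestronglyMeasurable ?_
  filter_upwards [ae_restrict_mem measurableSet_Ioi] with r hr0
  have hfr := hf.2.1 r
  have hr0 : 0 < r := hr0
  rw [Real.norm_of_nonneg (by positivity), Pi.add_apply, ← mul_add]
  gcongr
  rcases le_total r 1 with h | h
  · nlinarith [pow_le_pow_of_le_one hr0.le h (show 3 ≤ 7 by norm_num), pow_pos hr0 8]
  · nlinarith [pow_le_pow_right₀ h (show 7 ≤ 8 by norm_num), pow_pos hr0 3]

lemma memS.integrable_collisionWeight_mul (hf : memS h3 h8 hinf f) :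
    Integrable (fun r => collisionWeight r * f r) := by
  have h := hf.integrableOn_pow_two_and_integral_le.1.add hf.integrableOn_pow_seven
  rw [← integrable_indicator_iff measurableSet_Ioi] at h
  refine h.congr (ae_of_all _ fun r => ?_)
  by_cases hr : r ∈ Ioi (0 : ℝ) <;> simp [collisionWeight, hr]
  ring

lemma memS.integrableOn_abs_sub_mul_pow {k : ℕ} (hf : memS h3 h8 hinf f) (hg : memS h3 h8 hinf g)
    (hfk : IntegrableOn (fun r => f r * r ^ k) (Ioi (0 : ℝ)))
    (hgk : IntegrableOn (fun r => g r * r ^ k) (Ioi (0 : ℝ))) :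
    IntegrableOn (fun r => |f r - g r| * r ^ k) (Ioi (0 : ℝ)) ∧
      ∫ r in Ioi (0 : ℝ), |f r - g r| * r ^ k ≤
        (∫ r in Ioi (0 : ℝ), f r * r ^ k) + ∫ r in Ioi (0 : ℝ), g r * r ^ k := by
  have hle : ∀ r ∈ Ioi (0 : ℝ), |f r - g r| * r ^ k ≤ f r * r ^ k + g r * r ^ k := by
    intro r (hr : 0 < r)
    rw [← add_mul]
    gcongr
    rw [abs_le]
    constructor <;> linarith [hf.2.1 r, hg.2.1 r]
  have hint : IntegrableOn (fun r => |f r - g r| * r ^ k) (Ioi (0 : ℝ)) := by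
    refine Integrable.mono' (hfk.add hgk)
      ((hf.1.sub hg.1).abs.mul (by fun_prop)).aestronglyMeasurable ?_
    filter_upwards [ae_restrict_mem measurableSet_Ioi] with r hr
    have hr0 : 0 < r := hr
    rw [Real.norm_of_nonneg (by positivity)]
    exact hle r hr
  refine ⟨hint, ?_⟩
  rw [← integral_add hfk hgk]
  exact setIntegral_mono_on hint (hfk.add hgk) measurableSet_Ioi hle

lemma memS.dS_le (hf : memS h3 h8 hinf f) (hg : memS h3 h8 hinf g) :
    dS f g ≤ 2 * (hinf + h3) := by
  have h := (hf.integrableOn_abs_sub_mul_pow hg hf.integrableOn_pow_two_and_integral_le.1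
    hg.integrableOn_pow_two_and_integral_le.1).2
  unfold dS
  linarith [hf.integrableOn_pow_two_and_integral_le.2, hg.integrableOn_pow_two_and_integral_le.2]

/-- Interpolation of the seventh moment of `|f - g|` between the second and the eighth. -/
lemma memS.integral_abs_sub_mul_pow_seven_le (hf : memS h3 h8 hinf f) (hg : memS h3 h8 hinf g) :
    ∫ r in Ioi (0 : ℝ), |f r - g r| * r ^ 7 ≤ (1 + 2 * h8) * dS f g ^ ((1 : ℝ) / 6) := by
  have h2 := (hf.integrableOn_abs_sub_mul_pow hg hf.integrableOn_pow_two_and_integral_le.1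
    hg.integrableOn_pow_two_and_integral_le.1).1
  have h7 := (hf.integrableOn_abs_sub_mul_pow hg hf.integrableOn_pow_seven
    hg.integrableOn_pow_seven).1
  obtain ⟨h8i, h8b⟩ := hf.integrableOn_abs_sub_mul_pow hg hf.integrableOn_pow_eight
    hg.integrableOn_pow_eight
  have key : ∀ R : ℝ, 0 < R →
      ∫ r in Ioi (0 : ℝ), |f r - g r| * r ^ 7 ≤ R ^ 5 * dS f g + R⁻¹ * (2 * h8) := by
    intro R hR
    have hle : ∫ r in Ioi (0 : ℝ), |f r - g r| * r ^ 7 ≤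
        ∫ r in Ioi (0 : ℝ), (R ^ 5 * (|f r - g r| * r ^ 2) + R⁻¹ * (|f r - g r| * r ^ 8)) := by
      refine setIntegral_mono_on h7 ((h2.const_mul _).add (h8i.const_mul _)) measurableSet_Ioi ?_
      intro r (hr : 0 < r)
      have : r ^ 7 ≤ R ^ 5 * r ^ 2 + R⁻¹ * r ^ 8 := by
        rcases le_total r R with h | h
        · have h5 : r ^ 5 ≤ R ^ 5 := by gcongr
          have : 0 ≤ R⁻¹ * r ^ 8 := by positivity
          nlinarith [pow_pos hr 2]
        · have h1 : 1 ≤ R⁻¹ * r := by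
            rw [inv_mul_eq_div, one_le_div hR]
            exact h
          have : 0 ≤ R ^ 5 * r ^ 2 := by positivity
          nlinarith [pow_pos hr 7]
      calc |f r - g r| * r ^ 7 ≤ |f r - g r| * (R ^ 5 * r ^ 2 + R⁻¹ * r ^ 8) := by gcongr
        _ = _ := by ring
    rw [integral_add (h2.const_mul _) (h8i.const_mul _), integral_const_mul,
      integral_const_mul] at hle
    refine hle.trans ?_
    unfold dS
    gcongr
    linarith [hf.integral_pow_eight_le, hg.integral_pow_eight_le]
  rcases (dS_nonneg f g).eq_or_lt with hd | hd
  · rw [← hd, zero_rpow (by norm_num), mul_zero]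
    have hlim : Tendsto (fun R : ℝ => R⁻¹ * (2 * h8)) atTop (nhds 0) := by
      simpa using tendsto_inv_atTop_zero.mul_const (2 * h8)
    refine ge_of_tendsto hlim ?_
    filter_upwards [eventually_gt_atTop 0] with R hR
    simpa [← hd] using key R hR
  · refine (key (dS f g ^ (-(1 : ℝ) / 6)) (by positivity)).trans (le_of_eq ?_)
    rw [← rpow_natCast, ← rpow_mul hd.le, ← rpow_neg hd.le]
    nth_rewrite 2 [← rpow_one (dS f g)]
    rw [← rpow_add hd]
    norm_num
    ring

lemma memS.integrable_collisionWeight_mul_abs_sub (hf : memS h3 h8 hinf f)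
    (hg : memS h3 h8 hinf g) : Integrable (fun r => collisionWeight r * |f r - g r|) := by
  refine (hf.integrable_collisionWeight_mul.sub hg.integrable_collisionWeight_mul).abs.congr
    (ae_of_all _ fun r => ?_)
  simp only [Pi.sub_apply]
  rw [← mul_sub, abs_mul, abs_of_nonneg (collisionWeight_nonneg r)]

lemma memS.integral_collisionWeight_mul_abs_sub_le (hf : memS h3 h8 hinf f)
    (hg : memS h3 h8 hinf g) (h8p : 0 < h8) :
    ∫ r, collisionWeight r * |f r - g r| ≤ (1 + 2 * h8) * holderModulus (dS f g) := by
  have h2 := (hf.integrableOn_abs_sub_mul_pow hg hf.integrableOn_pow_two_and_integral_le.1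
    hg.integrableOn_pow_two_and_integral_le.1).1
  have h7 := (hf.integrableOn_abs_sub_mul_pow hg hf.integrableOn_pow_seven
    hg.integrableOn_pow_seven).1
  have heq : ∫ r, collisionWeight r * |f r - g r| =
      dS f g + ∫ r in Ioi (0 : ℝ), |f r - g r| * r ^ 7 := by
    unfold dS
    rw [← integral_add h2 h7, ← integral_indicator measurableSet_Ioi]
    congr 1 with r
    by_cases hr : r ∈ Ioi (0 : ℝ) <;> simp [collisionWeight, hr]
    ring
  rw [heq, holderModulus]
  nlinarith [hf.integral_abs_sub_mul_pow_seven_le hg, dS_nonneg f g]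

lemma memS.integral_collisionWeight_mul_le (hf : memS h3 h8 hinf f) :
    ∫ r, collisionWeight r * f r ≤ hinf + 2 * h3 + h8 := by
  obtain ⟨h2, h2b⟩ := hf.integrableOn_pow_two_and_integral_le
  have h3i := hf.integrableOn_pow_three
  have h8i := hf.integrableOn_pow_eight
  have heq : ∫ r, collisionWeight r * f r =
      (∫ r in Ioi (0 : ℝ), f r * r ^ 2) + ∫ r in Ioi (0 : ℝ), f r * r ^ 7 := by
    rw [← integral_add h2 hf.integrableOn_pow_seven, ← integral_indicator measurableSet_Ioi]
    congr 1 with r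
    by_cases hr : r ∈ Ioi (0 : ℝ) <;> simp [collisionWeight, hr]
    ring
  have hle : ∫ r in Ioi (0 : ℝ), f r * r ^ 7 ≤
      ∫ r in Ioi (0 : ℝ), (f r * r ^ 3 + f r * r ^ 8) := by
    refine setIntegral_mono_on hf.integrableOn_pow_seven (h3i.add h8i) measurableSet_Ioi ?_
    intro r (hr : 0 < r)
    have hfr := hf.2.1 r
    rw [← mul_add]
    gcongr
    rcases le_total r 1 with h | h
    · nlinarith [pow_le_pow_of_le_one hr.le h (show 3 ≤ 7 by norm_num), pow_pos hr 8]
    · nlinarith [pow_le_pow_right₀ h (show 7 ≤ 8 by norm_num), pow_pos hr 3]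
  rw [integral_add h3i h8i, hf.integral_pow_three] at hle
  linarith [hf.integral_pow_eight_le]

end Moments

lemma Kker_nonneg (x y : ℝ) : 0 ≤ Kker x y := by
  unfold Kker; positivity

/-- The density `y² (x - y)² x² h(x)` on the wedge `0 < y < x`. -/
noncomputable def linearDensity (h : ℝ → ℝ) : ℝ × ℝ → ℝ :=
  {z : ℝ × ℝ | 0 < z.2 ∧ z.2 < z.1}.indicator fun z => Kker z.2 (z.1 - z.2) * h z.1

lemma integrable_linearDensity_and_integral_le {h : ℝ → ℝ} (hm : Measurable h)
    (h0 : ∀ x, 0 ≤ h x) (hi : Integrable fun x => collisionWeight x * h x) :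
    Integrable (linearDensity h) ∧ ∫ z, linearDensity h z ≤ ∫ x, collisionWeight x * h x := by
  have hset : MeasurableSet {z : ℝ × ℝ | 0 < z.2 ∧ z.2 < z.1} :=
    (measurableSet_lt measurable_const measurable_snd).inter
      (measurableSet_lt measurable_snd measurable_fst)
  have hsec : ∀ x, (fun y => linearDensity h (x, y)) =
      (Ioo 0 x).indicator (fun y => Kker y (x - y) * h x) := by
    intro x
    ext y
    simp [linearDensity, indicator, mem_Ioo]
  have hnn : ∀ z, 0 ≤ linearDensity h z := fun z =>
    indicator_nonneg (fun z _ => mul_nonneg (Kker_nonneg _ _) (h0 _)) z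
  have hsec_int : ∀ x, Integrable (fun y => linearDensity h (x, y)) := by
    intro x
    have hcont : Continuous fun y => Kker y (x - y) * h x := by unfold Kker; fun_prop
    rw [hsec, integrable_indicator_iff measurableSet_Ioo]
    exact (hcont.continuousOn.integrableOn_Icc (a := 0) (b := x)).mono_set Ioo_subset_Icc_self
  have hsec_le : ∀ x, ∫ y, linearDensity h (x, y) ≤ collisionWeight x * h x := by
    intro x
    rcases le_or_gt x 0 with hx | hx
    · rw [hsec, Ioo_eq_empty (not_lt.2 hx)]
      simpa using mul_nonneg (collisionWeight_nonneg x) (h0 x)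
    · have hI := hsec_int x
      rw [hsec, integrable_indicator_iff measurableSet_Ioo] at hI
      rw [hsec, integral_indicator measurableSet_Ioo]
      calc ∫ y in Ioo 0 x, Kker y (x - y) * h x ≤ ∫ y in Ioo 0 x, x ^ 6 * h x := by
            refine setIntegral_mono_on hI (integrableOn_const (by simp)) measurableSet_Ioo ?_
            rintro y ⟨hy0, hyx⟩
            have hx0 := h0 x
            have hy : 0 ≤ x - y := by linarith
            gcongr
            calc Kker y (x - y) = y ^ 2 * (x - y) ^ 2 * x ^ 2 := by unfold Kker; ring
              _ ≤ x ^ 2 * x ^ 2 * x ^ 2 := by gcongr; linarith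
              _ = x ^ 6 := by ring
        _ = x ^ 7 * h x := by
            simp [hx.le]
            ring
        _ ≤ collisionWeight x * h x := by
            refine mul_le_mul_of_nonneg_right ?_ (h0 x)
            rw [collisionWeight, indicator_of_mem (show x ∈ Ioi 0 from hx)]
            linarith [pow_pos hx 2]
  have hmeas : AEStronglyMeasurable (linearDensity h) (volume.prod volume) := by
    refine (Measurable.indicator ?_ hset).aestronglyMeasurable
    unfold Kker
    exact Measurable.mul (by fun_prop) (hm.comp measurable_fst)
  have hint : Integrable (linearDensity h) (volume.prod volume) := by
    refine (integrable_prod_iff hmeas).2 ⟨ae_of_all _ hsec_int, ?_⟩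
    refine Integrable.mono' hi hmeas.norm.integral_prod_right' (ae_of_all _ fun x => ?_)
    simp only [Real.norm_of_nonneg (hnn _)]
    rw [Real.norm_of_nonneg (integral_nonneg fun y => hnn _)]
    exact hsec_le x
  refine ⟨hint, (integral_prod _ hint).le.trans ?_⟩
  exact integral_mono hint.integral_prod_left hi hsec_le

/-- An operator mapping the invariant set to integrable profiles, with modulus of continuity
`holderModulus` from `dS` to `L¹(0,∞)`. -/
def HolderL1 (h3 h8 hinf : ℝ) (P : (ℝ → ℝ) → ℝ → ℝ) : Prop :=
  ∃ C : ℝ, 0 ≤ C ∧ ∀ f g, memS h3 h8 hinf f → memS h3 h8 hinf g →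
    IntegrableOn (P f) (Ioi 0) ∧
      ∫ r in Ioi (0 : ℝ), |P f r - P g r| ≤ C * holderModulus (dS f g)

namespace HolderL1

variable {h3 h8 hinf : ℝ} {P Q : (ℝ → ℝ) → ℝ → ℝ}

lemma const_mul (hP : HolderL1 h3 h8 hinf P) (c : ℝ) :
    HolderL1 h3 h8 hinf (fun f r => c * P f r) := by
  obtain ⟨C, hC, h⟩ := hP
  refine ⟨|c| * C, by positivity, fun f g hf hg => ⟨(h f g hf hg).1.const_mul c, ?_⟩⟩
  simp only [← mul_sub, abs_mul]
  rw [integral_const_mul, mul_assoc]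
  exact mul_le_mul_of_nonneg_left (h f g hf hg).2 (abs_nonneg c)

lemma add (hP : HolderL1 h3 h8 hinf P) (hQ : HolderL1 h3 h8 hinf Q) :
    HolderL1 h3 h8 hinf (fun f r => P f r + Q f r) := by
  obtain ⟨C, hC, h⟩ := hP
  obtain ⟨D, hD, k⟩ := hQ
  refine ⟨C + D, by positivity, fun f g hf hg => ⟨(h f g hf hg).1.add (k f g hf hg).1, ?_⟩⟩
  have hp := ((h f g hf hg).1.sub (h g f hg hf).1).abs
  have hq := ((k f g hf hg).1.sub (k g f hg hf).1).abs
  have hpq := (((h f g hf hg).1.add (k f g hf hg).1).sub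
    ((h g f hg hf).1.add (k g f hg hf).1)).abs
  calc ∫ r in Ioi (0 : ℝ), |P f r + Q f r - (P g r + Q g r)|
      ≤ ∫ r in Ioi (0 : ℝ), (|P f r - P g r| + |Q f r - Q g r|) := by
        refine integral_mono hpq (hp.add hq) fun r => ?_
        simpa only [add_sub_add_comm] using abs_add_le (P f r - P g r) (Q f r - Q g r)
    _ = (∫ r in Ioi (0 : ℝ), |P f r - P g r|) + ∫ r in Ioi (0 : ℝ), |Q f r - Q g r| :=
        integral_add hp hq
    _ ≤ (C + D) * holderModulus (dS f g) := by
        linarith [(h f g hf hg).2, (k f g hf hg).2]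

lemma sub (hP : HolderL1 h3 h8 hinf P) (hQ : HolderL1 h3 h8 hinf Q) :
    HolderL1 h3 h8 hinf (fun f r => P f r - Q f r) := by
  simpa only [neg_one_mul, ← sub_eq_add_neg] using hP.add (hQ.const_mul (-1))

lemma exists_integral_abs_le (hP : HolderL1 h3 h8 hinf P) :
    ∃ B : ℝ, 0 ≤ B ∧ ∀ f, memS h3 h8 hinf f → ∫ r in Ioi (0 : ℝ), |P f r| ≤ B := by
  obtain ⟨C, hC, h⟩ := hP
  by_cases hS : ∃ f₀, memS h3 h8 hinf f₀
  · obtain ⟨f₀, hf₀⟩ := hS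
    have hD : 0 ≤ 2 * (hinf + h3) := (dS_nonneg _ _).trans (hf₀.dS_le hf₀)
    have h₀ := (h f₀ f₀ hf₀ hf₀).1
    refine ⟨C * holderModulus (2 * (hinf + h3)) + ∫ r in Ioi (0 : ℝ), |P f₀ r|,
      add_nonneg (mul_nonneg hC (holderModulus_nonneg hD))
        (integral_nonneg fun r => abs_nonneg _), fun f hf => ?_⟩
    have h₁ := (h f f hf hf).1
    calc ∫ r in Ioi (0 : ℝ), |P f r|
        ≤ ∫ r in Ioi (0 : ℝ), (|P f r - P f₀ r| + |P f₀ r|) := by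
          refine integral_mono h₁.abs ((h₁.sub h₀).abs.add h₀.abs) fun r => ?_
          simpa using abs_add_le (P f r - P f₀ r) (P f₀ r)
      _ = (∫ r in Ioi (0 : ℝ), |P f r - P f₀ r|) + ∫ r in Ioi (0 : ℝ), |P f₀ r| :=
          integral_add (h₁.sub h₀).abs h₀.abs
      _ ≤ _ := by
          gcongr
          refine (h f f₀ hf hf₀).2.trans ?_
          gcongr
          exact holderModulus_mono (dS_nonneg _ _) (hf.dS_le hf₀)
  · exact ⟨0, le_rfl, fun f hf => (hS ⟨f, hf⟩).elim⟩

/-- An operator given by integrating out one variable of a two-variable density, after a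
measure-preserving change of variables, inherits the continuity of the density in `L¹(ℝ²)`. -/
lemma of_prod {F : (ℝ → ℝ) → ℝ × ℝ → ℝ} {φ : ℝ × ℝ → ℝ × ℝ} (hφ : MeasurePreserving φ)
    (hP : ∀ f r, 0 < r → P f r = ∫ s, F f (φ (r, s)))
    (hF : ∃ C : ℝ, 0 ≤ C ∧ ∀ f g, memS h3 h8 hinf f → memS h3 h8 hinf g →
      Integrable (F f) ∧ ∫ z, |F f z - F g z| ≤ C * holderModulus (dS f g)) :
    HolderL1 h3 h8 hinf P := by
  obtain ⟨C, hC, h⟩ := hF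
  refine ⟨C, hC, fun f g hf hg => ?_⟩
  have key : ∀ {f}, memS h3 h8 hinf f → Integrable (fun z => F f (φ z)) (volume.prod volume) :=
    fun hf => hφ.integrable_comp_of_integrable (h _ _ hf hf).1
  have hint : ∀ {f}, memS h3 h8 hinf f → Integrable (fun r => ∫ s, F f (φ (r, s))) :=
    fun hf => (key hf).integral_prod_left
  refine ⟨(hint hf).integrableOn.congr_fun (fun r hr => (hP f r hr).symm) measurableSet_Ioi, ?_⟩
  have habs := ((key hf).sub (key hg)).abs
  calc ∫ r in Ioi (0 : ℝ), |P f r - P g r|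
      = ∫ r in Ioi (0 : ℝ), |(∫ s, F f (φ (r, s))) - ∫ s, F g (φ (r, s))| :=
        setIntegral_congr_fun measurableSet_Ioi fun r hr => by
          simp only [hP f r hr, hP g r hr]
    _ ≤ ∫ r, |(∫ s, F f (φ (r, s))) - ∫ s, F g (φ (r, s))| :=
        setIntegral_le_integral ((hint hf).sub (hint hg)).abs (ae_of_all _ fun r => abs_nonneg _)
    _ ≤ ∫ r, ∫ s, |F f (φ (r, s)) - F g (φ (r, s))| := by
        refine integral_mono_ae ((hint hf).sub (hint hg)).abs habs.integral_prod_left ?_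
        filter_upwards [(key hf).prod_right_ae, (key hg).prod_right_ae] with r h₁ h₂
        rw [← integral_sub h₁ h₂]
        exact abs_integral_le_integral_abs
    _ = ∫ z, |F f (φ z) - F g (φ z)| := (integral_prod _ habs).symm
    _ = ∫ z, |F f z - F g z| := by
        have hm : AEStronglyMeasurable (fun z => |F f z - F g z|) (Measure.map φ volume) := by
          rw [hφ.map_eq]
          exact ((h f g hf hg).1.sub (h g f hg hf).1).abs.aestronglyMeasurable
        rw [← integral_map hφ.aemeasurable hm, hφ.map_eq]
    _ ≤ _ := (h f g hf hg).2

/-- Quadratic operators whose density is dominated by the collision kernel. -/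
lemma of_quadratic (h3p : 0 < h3) (h8p : 0 < h8) (hinfp : 0 < hinf) {w : ℝ × ℝ → ℝ}
    (hw : Measurable w) (hw0 : ∀ x y, ¬ (0 < x ∧ 0 < y) → w (x, y) = 0)
    (hwK : ∀ x y, 0 < x → 0 < y → |w (x, y)| ≤ Kker x y) {φ : ℝ × ℝ → ℝ × ℝ}
    (hφ : MeasurePreserving φ)
    (hP : ∀ f r, 0 < r →
      P f r = ∫ s, w (φ (r, s)) * f (φ (r, s)).1 * f (φ (r, s)).2) :
    HolderL1 h3 h8 hinf P := by
  refine of_prod (F := fun f z => w z * f z.1 * f z.2) hφ hP ?_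
  have hwle : ∀ z, |w z| ≤ 4 * (collisionWeight z.1 * collisionWeight z.2) := by
    rintro ⟨x, y⟩
    by_cases h : 0 < x ∧ 0 < y
    · obtain ⟨hx, hy⟩ := h
      refine (hwK x y hx hy).trans ?_
      have key : ∀ t : ℝ, 0 < t → t ^ 4 ≤ t ^ 2 + t ^ 7 := by
        intro t ht
        rcases le_total t 1 with h | h
        · nlinarith [pow_le_pow_of_le_one ht.le h (show 2 ≤ 4 by norm_num), pow_pos ht 7]
        · nlinarith [pow_le_pow_right₀ h (show 4 ≤ 7 by norm_num), pow_pos ht 2]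
      simp only [collisionWeight, mem_Ioi, hx, hy, indicator_of_mem, Kker]
      have h₂ : x ^ 4 * y ^ 2 ≤ (x ^ 2 + x ^ 7) * (y ^ 2 + y ^ 7) := by
        gcongr
        · exact key x hx
        · linarith [pow_pos hy 7]
      have h₃ : x ^ 2 * y ^ 4 ≤ (x ^ 2 + x ^ 7) * (y ^ 2 + y ^ 7) := by
        gcongr
        · linarith [pow_pos hx 7]
        · exact key y hy
      nlinarith [mul_nonneg (mul_nonneg (sq_nonneg x) (sq_nonneg y)) (sq_nonneg (x - y))]
    · rw [hw0 x y h, abs_zero]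
      have := mul_nonneg (collisionWeight_nonneg x) (collisionWeight_nonneg y)
      simpa using this
  refine ⟨8 * (hinf + 2 * h3 + h8) * (1 + 2 * h8), by positivity, fun f g hf hg => ?_⟩
  have hint : ∀ {f}, memS h3 h8 hinf f →
      Integrable (fun z : ℝ × ℝ => w z * f z.1 * f z.2) := by
    intro f hf
    have hdom := ((hf.integrable_collisionWeight_mul.mul_prod
      hf.integrable_collisionWeight_mul).const_mul 4)
    refine Integrable.mono' hdom ((hw.mul (hf.1.comp measurable_fst)).mul
      (hf.1.comp measurable_snd)).aestronglyMeasurable (ae_of_all _ fun z => ?_)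
    have h₁ := hf.2.1 z.1
    have h₂ := hf.2.1 z.2
    rw [Real.norm_eq_abs, abs_mul, abs_mul, abs_of_nonneg h₁, abs_of_nonneg h₂]
    calc |w z| * f z.1 * f z.2
        ≤ 4 * (collisionWeight z.1 * collisionWeight z.2) * f z.1 * f z.2 := by
          gcongr
          exact hwle z
      _ = _ := by ring
  refine ⟨hint hf, ?_⟩
  have hh := hf.integrable_collisionWeight_mul_abs_sub hg
  have hA := hh.mul_prod hf.integrable_collisionWeight_mul
  have hB := hg.integrable_collisionWeight_mul.mul_prod hh
  have hω := hf.integral_collisionWeight_mul_abs_sub_le hg h8p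
  have hbound : ∀ {f}, memS h3 h8 hinf f → 0 ≤ ∫ x, collisionWeight x * f x :=
    fun hf => integral_nonneg fun x => mul_nonneg (collisionWeight_nonneg x) (hf.2.1 x)
  have hh0 : 0 ≤ ∫ x, collisionWeight x * |f x - g x| :=
    integral_nonneg fun x => mul_nonneg (collisionWeight_nonneg x) (abs_nonneg _)
  calc ∫ z : ℝ × ℝ, |w z * f z.1 * f z.2 - w z * g z.1 * g z.2|
      ≤ ∫ z : ℝ × ℝ, 4 * (collisionWeight z.1 * |f z.1 - g z.1| * (collisionWeight z.2 * f z.2) +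
          collisionWeight z.1 * g z.1 * (collisionWeight z.2 * |f z.2 - g z.2|)) := by
        refine integral_mono ((hint hf).sub (hint hg)).abs ((hA.add hB).const_mul 4) fun z => ?_
        have h₁ := hf.2.1 z.2
        have h₂ := hg.2.1 z.1
        have heq : w z * f z.1 * f z.2 - w z * g z.1 * g z.2 =
            w z * ((f z.1 - g z.1) * f z.2 + g z.1 * (f z.2 - g z.2)) := by ring
        have hab : |(f z.1 - g z.1) * f z.2 + g z.1 * (f z.2 - g z.2)| ≤
            |f z.1 - g z.1| * f z.2 + g z.1 * |f z.2 - g z.2| := by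
          refine (abs_add_le _ _).trans (le_of_eq ?_)
          rw [abs_mul, abs_mul, abs_of_nonneg h₁, abs_of_nonneg h₂]
        simp only [heq, abs_mul (w z)]
        refine (mul_le_mul (hwle z) hab (abs_nonneg _) ((abs_nonneg _).trans (hwle z))).trans
          (le_of_eq ?_)
        ring
    _ = 4 * ((∫ x, collisionWeight x * |f x - g x|) * (∫ x, collisionWeight x * f x) +
          (∫ x, collisionWeight x * g x) * ∫ x, collisionWeight x * |f x - g x|) := by
        rw [integral_const_mul]
        congr 1
        refine (integral_add hA hB).trans ?_
        rw [← integral_prod_mul, ← integral_prod_mul]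
    _ ≤ 4 * ((∫ x, collisionWeight x * |f x - g x|) * (hinf + 2 * h3 + h8) +
          (hinf + 2 * h3 + h8) * ∫ x, collisionWeight x * |f x - g x|) := by
        gcongr
        · exact hf.integral_collisionWeight_mul_le
        · exact hg.integral_collisionWeight_mul_le
    _ = 8 * (hinf + 2 * h3 + h8) * ∫ x, collisionWeight x * |f x - g x| := by ring
    _ ≤ _ := by
        rw [mul_assoc (8 * _)]
        gcongr

/-- Linear operators obtained by integrating out a variable of `linearDensity`. -/
lemma of_linear (h8p : 0 < h8) {φ : ℝ × ℝ → ℝ × ℝ} (hφ : MeasurePreserving φ)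
    (hP : ∀ f r, 0 < r → P f r = ∫ s, linearDensity f (φ (r, s))) :
    HolderL1 h3 h8 hinf P := by
  refine of_prod (F := linearDensity) hφ hP
    ⟨1 + 2 * h8, by positivity, fun f g hf hg => ⟨?_, ?_⟩⟩
  · exact (integrable_linearDensity_and_integral_le hf.1 hf.2.1
      hf.integrable_collisionWeight_mul).1
  · have heq : ∀ z, |linearDensity f z - linearDensity g z| =
        linearDensity (fun x => |f x - g x|) z := by
      intro z
      by_cases hz : 0 < z.2 ∧ z.2 < z.1
      · have hK : 0 ≤ Kker z.2 (z.1 - z.2) := Kker_nonneg _ _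
        simp [linearDensity, hz, ← mul_sub, abs_mul, abs_of_nonneg hK]
      · simp [linearDensity, hz]
    simp only [heq]
    exact (integrable_linearDensity_and_integral_le (hf.1.sub hg.1).abs
      (fun x => abs_nonneg _) (hf.integrable_collisionWeight_mul_abs_sub hg)).2.trans
      (hf.integral_collisionWeight_mul_abs_sub_le hg h8p)

end HolderL1

lemma measurePreserving_snd_fst_sub_snd :
    MeasurePreserving (fun z : ℝ × ℝ => (z.2, z.1 - z.2)) := by
  have h := measurePreserving_prod_neg_add_swap (volume : Measure ℝ) (volume : Measure ℝ)
  simp only [neg_add_eq_sub] at h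
  exact h

lemma measurePreserving_snd_snd_sub_fst :
    MeasurePreserving (fun z : ℝ × ℝ => (z.2, z.2 - z.1)) := by
  have h := ((MeasurePreserving.id (volume : Measure ℝ)).prod
    (Measure.measurePreserving_neg (volume : Measure ℝ))).comp measurePreserving_snd_fst_sub_snd
  have heq : (Prod.map id Neg.neg ∘ fun z : ℝ × ℝ => (z.2, z.1 - z.2)) =
      fun z : ℝ × ℝ => (z.2, z.2 - z.1) := by
    ext z <;> simp
  rwa [heq] at h

/-- The collision operator is Hölder continuous from `dS` to `L¹(0,∞)`. -/
lemma holderL1_Qcol {h3 h8 hinf : ℝ} (h3p : 0 < h3) (h8p : 0 < h8) (hinfp : 0 < hinf) :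
    HolderL1 h3 h8 hinf Qcol := by
  have hpos : MeasurableSet {z : ℝ × ℝ | 0 < z.1 ∧ 0 < z.2} :=
    (measurableSet_lt measurable_const measurable_fst).inter
      (measurableSet_lt measurable_const measurable_snd)
  have hlt : MeasurableSet {z : ℝ × ℝ | 0 < z.1 ∧ z.1 < z.2} :=
    (measurableSet_lt measurable_const measurable_fst).inter
      (measurableSet_lt measurable_fst measurable_snd)
  have hgt : MeasurableSet {z : ℝ × ℝ | 0 < z.2 ∧ z.2 < z.1} :=
    (measurableSet_lt measurable_const measurable_snd).inter
      (measurableSet_lt measurable_snd measurable_fst)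
  have hsub : ∀ {x y : ℝ}, 0 < x → 0 < y → (x - y) ^ 2 ≤ (x + y) ^ 2 := fun hx hy => by
    nlinarith [mul_pos hx hy]
  have gain₁ : HolderL1 h3 h8 hinf
      (fun f r => ∫ s in (0 : ℝ)..r, Kker s (r - s) * f s * f (r - s)) := by
    refine HolderL1.of_quadratic h3p h8p hinfp
      (w := {z : ℝ × ℝ | 0 < z.1 ∧ 0 < z.2}.indicator fun z => Kker z.1 z.2)
      (Measurable.indicator (by unfold Kker; fun_prop) hpos)
      (fun x y h => indicator_of_notMem
        (show (x, y) ∉ {z : ℝ × ℝ | 0 < z.1 ∧ 0 < z.2} from h) _)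
      (fun x y hx hy => ?_)
      measurePreserving_snd_fst_sub_snd (fun f r hr => ?_)
    · rw [indicator_of_mem (show (x, y) ∈ {z : ℝ × ℝ | 0 < z.1 ∧ 0 < z.2} from ⟨hx, hy⟩),
        abs_of_nonneg (Kker_nonneg _ _)]
    · rw [intervalIntegral.integral_of_le hr.le, integral_Ioc_eq_integral_Ioo,
        ← integral_indicator measurableSet_Ioo]
      congr 1 with s
      simp only [indicator, mem_Ioo, mem_ofPred_eq, sub_pos]
      split_ifs <;> simp
  have gain₂ : HolderL1 h3 h8 hinf
      (fun f r => ∫ s in Ioi r, Kker r (s - r) * f s * f (s - r)) := by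
    refine HolderL1.of_quadratic h3p h8p hinfp
      (w := {z : ℝ × ℝ | 0 < z.2 ∧ z.2 < z.1}.indicator fun z => Kker (z.1 - z.2) z.2)
      (Measurable.indicator (by unfold Kker; fun_prop) hgt)
      (fun x y h => indicator_of_notMem (fun h' => h ⟨h'.1.trans h'.2, h'.1⟩) _)
      (fun x y hx hy => ?_)
      measurePreserving_snd_snd_sub_fst (fun f r hr => ?_)
    · by_cases h : y < x
      · rw [indicator_of_mem (show (x, y) ∈ {z : ℝ × ℝ | 0 < z.2 ∧ z.2 < z.1} from ⟨hy, h⟩),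
          abs_of_nonneg (Kker_nonneg _ _)]
        calc Kker (x - y) y = x ^ 2 * y ^ 2 * (x - y) ^ 2 := by unfold Kker; ring
          _ ≤ Kker x y := by unfold Kker; gcongr ?_ * ?_; exact hsub hx hy
      · rw [indicator_of_notMem (fun h' => h h'.2), abs_zero]
        exact Kker_nonneg _ _
    · rw [← integral_indicator measurableSet_Ioi]
      congr 1 with s
      simp only [indicator, mem_Ioi, mem_ofPred_eq, sub_pos, sub_sub_cancel, sub_lt_self_iff, hr,
        and_true]
      split_ifs <;> simp
  have loss₁ : HolderL1 h3 h8 hinf (fun f r => f r * ∫ s in Ioi r, Kker r (s - r) * f s) := by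
    refine HolderL1.of_quadratic h3p h8p hinfp
      (w := {z : ℝ × ℝ | 0 < z.1 ∧ z.1 < z.2}.indicator fun z => Kker z.1 (z.2 - z.1))
      (Measurable.indicator (by unfold Kker; fun_prop) hlt)
      (fun x y h => indicator_of_notMem (fun h' => h ⟨h'.1, h'.1.trans h'.2⟩) _)
      (fun x y hx hy => ?_)
      (MeasurePreserving.id _) (fun f r hr => ?_)
    · by_cases h : x < y
      · rw [indicator_of_mem (show (x, y) ∈ {z : ℝ × ℝ | 0 < z.1 ∧ z.1 < z.2} from ⟨hx, h⟩),
          abs_of_nonneg (Kker_nonneg _ _)]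
        calc Kker x (y - x) = x ^ 2 * y ^ 2 * (x - y) ^ 2 := by unfold Kker; ring
          _ ≤ Kker x y := by unfold Kker; gcongr ?_ * ?_; exact hsub hx hy
      · rw [indicator_of_notMem (fun h' => h h'.2), abs_zero]
        exact Kker_nonneg _ _
    · rw [← integral_indicator measurableSet_Ioi, ← integral_const_mul]
      congr 1 with s
      simp only [indicator, mem_Ioi, mem_ofPred_eq, hr, true_and, id]
      split_ifs <;> ring
  have loss₂ : HolderL1 h3 h8 hinf
      (fun f r => f r * ∫ s in (0 : ℝ)..r, Kker s (r - s) * f s) := by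
    refine HolderL1.of_quadratic h3p h8p hinfp
      (w := {z : ℝ × ℝ | 0 < z.2 ∧ z.2 < z.1}.indicator fun z => Kker z.2 (z.1 - z.2))
      (Measurable.indicator (by unfold Kker; fun_prop) hgt)
      (fun x y h => indicator_of_notMem (fun h' => h ⟨h'.1.trans h'.2, h'.1⟩) _)
      (fun x y hx hy => ?_)
      (MeasurePreserving.id _) (fun f r hr => ?_)
    · by_cases h : y < x
      · rw [indicator_of_mem (show (x, y) ∈ {z : ℝ × ℝ | 0 < z.2 ∧ z.2 < z.1} from ⟨hy, h⟩),
          abs_of_nonneg (Kker_nonneg _ _)]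
        calc Kker y (x - y) = x ^ 2 * y ^ 2 * (x - y) ^ 2 := by unfold Kker; ring
          _ ≤ Kker x y := by unfold Kker; gcongr ?_ * ?_; exact hsub hx hy
      · rw [indicator_of_notMem (fun h' => h h'.2), abs_zero]
        exact Kker_nonneg _ _
    · rw [intervalIntegral.integral_of_le hr.le, integral_Ioc_eq_integral_Ioo,
        ← integral_indicator measurableSet_Ioo, ← integral_const_mul]
      congr 1 with s
      simp only [indicator, mem_Ioo, mem_ofPred_eq, id]
      split_ifs <;> ring
  have loss₃ : HolderL1 h3 h8 hinf (fun f r => f r * ∫ s in Ioi (0 : ℝ), Kker r s * f s) := by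
    refine HolderL1.of_quadratic h3p h8p hinfp
      (w := {z : ℝ × ℝ | 0 < z.1 ∧ 0 < z.2}.indicator fun z => Kker z.1 z.2)
      (Measurable.indicator (by unfold Kker; fun_prop) hpos)
      (fun x y h => indicator_of_notMem
        (show (x, y) ∉ {z : ℝ × ℝ | 0 < z.1 ∧ 0 < z.2} from h) _)
      (fun x y hx hy => ?_)
      (MeasurePreserving.id _) (fun f r hr => ?_)
    · rw [indicator_of_mem (show (x, y) ∈ {z : ℝ × ℝ | 0 < z.1 ∧ 0 < z.2} from ⟨hx, hy⟩),
        abs_of_nonneg (Kker_nonneg _ _)]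
    · rw [← integral_indicator measurableSet_Ioi, ← integral_const_mul]
      congr 1 with s
      simp only [indicator, mem_Ioi, mem_ofPred_eq, hr, true_and, id]
      split_ifs <;> ring
  have linGain : HolderL1 h3 h8 hinf (fun f r => ∫ s in Ioi r, Kker r (s - r) * f s) := by
    refine HolderL1.of_linear h8p Measure.measurePreserving_swap fun f r hr => ?_
    rw [← integral_indicator measurableSet_Ioi]
    congr 1 with s
    simp [linearDensity, indicator, hr]
  have linLoss : HolderL1 h3 h8 hinf (fun f r => f r * ∫ s in (0 : ℝ)..r, Kker s (r - s)) := by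
    refine HolderL1.of_linear h8p (MeasurePreserving.id _) fun f r hr => ?_
    rw [intervalIntegral.integral_of_le hr.le, integral_Ioc_eq_integral_Ioo,
      ← integral_indicator measurableSet_Ioo, ← integral_const_mul]
    congr 1 with s
    simp only [linearDensity, indicator, mem_Ioo, mem_ofPred_eq, id]
    split_ifs <;> ring
  have heq : Qcol = fun f r =>
      8 * π ^ 2 *
        (((∫ s in (0 : ℝ)..r, Kker s (r - s) * f s * f (r - s)) +
          2 * (∫ s in Ioi r, Kker r (s - r) * f s * f (s - r))) +
          2 * ((f r * (∫ s in Ioi r, Kker r (s - r) * f s) -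
            f r * (∫ s in (0 : ℝ)..r, Kker s (r - s) * f s)) -
            f r * (∫ s in Ioi (0 : ℝ), Kker r s * f s))) +
      8 * π ^ 2 *
        (2 * (∫ s in Ioi r, Kker r (s - r) * f s) -
          f r * (∫ s in (0 : ℝ)..r, Kker s (r - s))) := by
    ext f r
    unfold Qcol Qq Lop
    ring
  rw [heq]
  exact (((gain₁.add (gain₂.const_mul 2)).add
    (((loss₁.sub loss₂).sub loss₃).const_mul 2)).const_mul _).add
    (((linGain.const_mul 2).sub linLoss).const_mul _)

lemma tendsto_holderModulus_zero : Tendsto holderModulus (nhds 0) (nhds 0) := by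
  have h : Continuous holderModulus := by
    unfold holderModulus
    exact (continuous_rpow_const (by norm_num)).add continuous_id
  have h0 : holderModulus 0 = 0 := by simp [holderModulus]
  simpa only [h0] using h.tendsto 0

/-- Along a `dS`-continuous curve in the invariant set, the total integral of an operator that is
Hölder continuous into `L¹` depends continuously on time. -/
lemma HolderL1.continuousOn_integral {h3 h8 hinf T : ℝ} {P : (ℝ → ℝ) → ℝ → ℝ}
    (hP : HolderL1 h3 h8 hinf P) {f : ℝ → ℝ → ℝ}
    (hf : ∀ t ∈ Icc (0 : ℝ) T, memS h3 h8 hinf (f t)) (hc : contS T f) :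
    ContinuousOn (fun t => ∫ r in Ioi (0 : ℝ), P (f t) r) (Icc 0 T) := by
  obtain ⟨C, -, h⟩ := hP
  intro t₀ ht₀
  have hd : Tendsto (fun t => dS (f t) (f t₀)) (nhdsWithin t₀ (Icc 0 T)) (nhds 0) := by
    rw [Metric.tendsto_nhdsWithin_nhds]
    intro ε hε
    obtain ⟨η, hη, H⟩ := hc t₀ ht₀ ε hε
    refine ⟨η, hη, fun t ht htη => ?_⟩
    rw [Real.dist_0_eq_abs, abs_of_nonneg (dS_nonneg _ _)]
    exact H t ht htη
  have hlim := (tendsto_holderModulus_zero.comp hd).const_mul C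
  rw [mul_zero] at hlim
  refine tendsto_iff_dist_tendsto_zero.2 (squeeze_zero' (Eventually.of_forall fun _ => dist_nonneg)
    ?_ hlim)
  filter_upwards [self_mem_nhdsWithin] with t ht
  rw [Real.dist_eq, ← integral_sub (h _ _ (hf t ht) (hf t ht)).1 (h _ _ (hf t₀ ht₀) (hf t₀ ht₀)).1]
  exact abs_integral_le_integral_abs.trans (h _ _ (hf t ht) (hf t₀ ht₀)).2

lemma kappa0_pos {mass : ℝ} (hmass : 0 < mass) : 0 < kappa0 mass := by
  unfold kappa0; positivity

lemma abs_sqrt_sub_sqrt_le {δ a b : ℝ} (hδ : 0 < δ) (ha : δ ≤ √a) (hb : δ ≤ √b) :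
    |√a - √b| ≤ |a - b| / (2 * δ) := by
  have ha0 : 0 ≤ a := (Real.sqrt_pos.1 (hδ.trans_le ha)).le
  have hb0 : 0 ≤ b := (Real.sqrt_pos.1 (hδ.trans_le hb)).le
  have h : a - b = (√a - √b) * (√a + √b) := by
    nlinarith [Real.sq_sqrt ha0, Real.sq_sqrt hb0]
  rw [le_div_iff₀ (by positivity), h, abs_mul]
  gcongr
  exact le_trans (by linarith) (le_abs_self _)

/-- Hölder continuity of the collision operator on the invariant set. -/
theorem holder_continuity_collision (mass h3 h8 hinf δ : ℝ) (hmass : 0 < mass) (h3p : 0 < h3)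
    (h8p : 0 < h8) (hinfp : 0 < hinf) (hδ : 0 < δ) :
    ∃ C₂ : ℝ, 0 < C₂ ∧ ∀ T : ℝ, 0 < T → ∃ C₁ : ℝ, 0 < C₁ ∧
      ∀ n0 : ℝ, 0 < n0 → ∀ f g : ℝ → ℝ → ℝ,
        (∀ t ∈ Icc (0 : ℝ) T, memS h3 h8 hinf (f t)) → contS T f →
        (∀ t ∈ Icc (0 : ℝ) T, memS h3 h8 hinf (g t)) → contS T g →
        (∀ t ∈ Icc (0 : ℝ) T, δ ≤ ncF mass n0 f t) →
        (∀ t ∈ Icc (0 : ℝ) T, δ ≤ ncF mass n0 g t) →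
        ∀ t s : ℝ, 0 ≤ t → t ≤ s → s ≤ T →
          (∫ r in Ioi (0 : ℝ),
              |kappa0 mass / ncF mass n0 f t * Qcol (f t) r -
                kappa0 mass / ncF mass n0 g s * Qcol (g s) r|) ≤
            C₁ * (sSup ((fun σ => dS (f σ) (g σ)) '' Icc (0 : ℝ) t) ^ ((1 : ℝ) / 6) +
                sSup ((fun σ => dS (f σ) (g σ)) '' Icc (0 : ℝ) t)) +
              C₂ * (dS (f t) (g s) ^ ((1 : ℝ) / 6) + dS (f t) (g s) + |t - s|) := by
  obtain ⟨C, hC, hQ⟩ := holderL1_Qcol h3p h8p hinfp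
  obtain ⟨B, hB, hQB⟩ := (holderL1_Qcol h3p h8p hinfp).exists_integral_abs_le
  have hκ := kappa0_pos hmass
  set κ := kappa0 mass
  refine ⟨κ / δ * C + κ / δ ^ 2 * B * (κ / δ) * B + 1, by positivity, fun T hT =>
    ⟨κ / δ ^ 2 * B * (κ / δ) * C * T + 1, by positivity, ?_⟩⟩
  intro n0 hn0 f g hf hfc hg hgc hfδ hgδ t s ht hts hsT
  have htT : t ∈ Icc 0 T := ⟨ht, hts.trans hsT⟩
  have hsT' : s ∈ Icc 0 T := ⟨ht.trans hts, hsT⟩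
  set D := sSup ((fun σ => dS (f σ) (g σ)) '' Icc (0 : ℝ) t)
  have hsub : Icc 0 t ⊆ Icc 0 T := Icc_subset_Icc_right htT.2
  have hdD : ∀ σ ∈ Icc 0 t, dS (f σ) (g σ) ≤ D := by
    intro σ hσ
    refine le_csSup ⟨2 * (hinf + h3), ?_⟩ (mem_image_of_mem _ hσ)
    rintro _ ⟨τ, hτ, rfl⟩
    exact (hf τ (hsub hτ)).dS_le (hg τ (hsub hτ))
  have hD0 : 0 ≤ D := (dS_nonneg _ _).trans (hdD 0 ⟨le_rfl, ht⟩)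
  have hcf := (holderL1_Qcol h3p h8p hinfp).continuousOn_integral hf hfc
  have hcg := (holderL1_Qcol h3p h8p hinfp).continuousOn_integral hg hgc
  set qf := fun σ => ∫ r in Ioi (0 : ℝ), Qcol (f σ) r with hqf
  set qg := fun σ => ∫ r in Ioi (0 : ℝ), Qcol (g σ) r with hqg
  have hif : IntervalIntegrable qf volume 0 t :=
    (hcf.mono (by rwa [uIcc_of_le ht])).intervalIntegrable
  have hig : IntervalIntegrable qg volume 0 t :=
    (hcg.mono (by rwa [uIcc_of_le ht])).intervalIntegrable
  have hig' : IntervalIntegrable qg volume t s :=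
    (hcg.mono (by
      rw [uIcc_of_le hts]
      exact Icc_subset_Icc ht hsT)).intervalIntegrable
  have hint : |(∫ σ in (0 : ℝ)..t, qf σ) - ∫ σ in (0 : ℝ)..s, qg σ| ≤
      C * holderModulus D * T + B * |t - s| := by
    have h₁ : ‖∫ σ in (0 : ℝ)..t, (qf σ - qg σ)‖ ≤ C * holderModulus D * |t - 0| := by
      refine intervalIntegral.norm_integral_le_of_norm_le_const fun σ hσ => ?_
      rw [uIoc_of_le ht] at hσ
      have hσt := Ioc_subset_Icc_self hσ
      have hfσ := hf σ (hsub hσt)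
      have hgσ := hg σ (hsub hσt)
      rw [Real.norm_eq_abs, hqf, hqg, ← integral_sub (hQ _ _ hfσ hgσ).1 (hQ _ _ hgσ hfσ).1]
      refine (abs_integral_le_integral_abs.trans (hQ _ _ hfσ hgσ).2).trans ?_
      gcongr
      exact holderModulus_mono (dS_nonneg _ _) (hdD σ hσt)
    have h₂ : ‖∫ σ in t..s, qg σ‖ ≤ B * |s - t| := by
      refine intervalIntegral.norm_integral_le_of_norm_le_const fun σ hσ => ?_
      rw [uIoc_of_le hts] at hσ
      exact abs_integral_le_integral_abs.trans
        (hQB _ (hg σ ⟨ht.trans hσ.1.le, hσ.2.trans hsT⟩))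
    rw [intervalIntegral.integral_sub hif hig, Real.norm_eq_abs] at h₁
    rw [← intervalIntegral.integral_add_adjacent_intervals hig hig', ← sub_sub]
    refine (abs_sub _ _).trans (add_le_add (h₁.trans ?_) (abs_sub_comm s t ▸ h₂))
    rw [sub_zero, abs_of_nonneg ht]
    have := holderModulus_nonneg hD0
    gcongr
    exact htT.2
  set a := ncF mass n0 f t with ha
  set b := ncF mass n0 g s with hb
  have haδ : δ ≤ a := hfδ t htT
  have hbδ : δ ≤ b := hgδ s hsT'
  have ha0 : 0 < a := hδ.trans_le haδ
  have hb0 : 0 < b := hδ.trans_le hbδ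
  have hab : |a - b| ≤ κ / δ * (C * holderModulus D * T + B * |t - s|) := by
    unfold ncF at ha hb
    rw [ha] at haδ ⊢
    rw [hb] at hbδ ⊢
    refine (abs_sqrt_sub_sqrt_le hδ haδ hbδ).trans ?_
    rw [sub_sub_sub_cancel_left, ← mul_sub, abs_mul, abs_of_nonneg (by positivity), abs_sub_comm]
    calc 2 * κ * |(∫ σ in (0 : ℝ)..t, qf σ) - ∫ σ in (0 : ℝ)..s, qg σ| / (2 * δ)
        = κ / δ * |(∫ σ in (0 : ℝ)..t, qf σ) - ∫ σ in (0 : ℝ)..s, qg σ| := by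
          field_simp
      _ ≤ _ := by gcongr
  have hcoef : |κ / a - κ / b| ≤ κ / δ ^ 2 * |a - b| := by
    have h : κ / a - κ / b = κ / (a * b) * (b - a) := by
      field_simp
    rw [h, abs_mul, abs_of_nonneg (by positivity), abs_sub_comm b a]
    gcongr
    rw [sq]
    gcongr
  have hft := hf t htT
  have hgs := hg s hsT'
  have hQf := (hQ _ _ hft hgs).1
  have hQg := (hQ _ _ hgs hft).1
  have hmain : ∫ r in Ioi (0 : ℝ), |κ / a * Qcol (f t) r - κ / b * Qcol (g s) r| ≤
      κ / δ * (C * holderModulus (dS (f t) (g s))) + κ / δ ^ 2 * |a - b| * B := by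
    calc ∫ r in Ioi (0 : ℝ), |κ / a * Qcol (f t) r - κ / b * Qcol (g s) r|
        ≤ ∫ r in Ioi (0 : ℝ), (κ / δ * |Qcol (f t) r - Qcol (g s) r| +
            κ / δ ^ 2 * |a - b| * |Qcol (g s) r|) := by
          refine integral_mono ((hQf.const_mul _).sub (hQg.const_mul _)).abs
            (((hQf.sub hQg).abs.const_mul _).add (hQg.abs.const_mul _)) fun r => ?_
          have h : κ / a * Qcol (f t) r - κ / b * Qcol (g s) r =
              κ / a * (Qcol (f t) r - Qcol (g s) r) + (κ / a - κ / b) * Qcol (g s) r := by ring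
          simp only [h]
          refine (abs_add_le _ _).trans ?_
          rw [abs_mul, abs_mul, abs_of_nonneg (by positivity : 0 ≤ κ / a)]
          gcongr
      _ = κ / δ * (∫ r in Ioi (0 : ℝ), |Qcol (f t) r - Qcol (g s) r|) +
            κ / δ ^ 2 * |a - b| * ∫ r in Ioi (0 : ℝ), |Qcol (g s) r| := by
          rw [← integral_const_mul, ← integral_const_mul]
          exact integral_add ((hQf.sub hQg).abs.const_mul _) (hQg.abs.const_mul _)
      _ ≤ _ := by
          gcongr
          · exact (hQ _ _ hft hgs).2
          · exact hQB _ hgs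
  have hω := holderModulus_nonneg hD0
  have hω' := holderModulus_nonneg (dS_nonneg (f t) (g s))
  change _ ≤ _ * holderModulus D + _ * (holderModulus (dS (f t) (g s)) + |t - s|)
  refine hmain.trans ?_
  have h₁ : κ / δ ^ 2 * |a - b| * B ≤
      κ / δ ^ 2 * (κ / δ * (C * holderModulus D * T + B * |t - s|)) * B := by gcongr
  have h₂ : 0 ≤ κ / δ * C * |t - s| := by positivity
  have h₃ : 0 ≤ κ / δ ^ 2 * B * (κ / δ) * B * holderModulus (dS (f t) (g s)) := by positivity
  have h₄ := abs_nonneg (t - s)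
  linarith
end
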